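/- arXiv:1904.01899 — 6 statements merged into one kernel-verified Lean document; each statement's English description precedes it below -/
import Mathlib

section
/- Fix a real constant k > 0. Let P = (x₀, y₀) with y₀ > 0 and let e ∈ ℝ with e ≠ x₀. Then there exists a unique pair of reals (a, c) with a > 0 such that P lies on the half-ellipse L_{kac} (i.e., (x₀ − c)² + k²y₀² = a²) and e is a Euclidean endpoint of that half-ellipse on the x-axis (i.e., e = c − a or e = c + a). -/
/-- Given `k > 0`, a point `(x₀, y₀)` of the upper half-plane and
a real `e ≠ x₀`, there is a unique pair `(a, c)` with `a > 0` such that the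
point lies on the half-ellipse `(x - c)^2 + k^2 y^2 = a^2` and `e` is one of
its endpoints `c - a`, `c + a` on the x-axis. -/
theorem unique_halfEllipse_through_point_with_endpoint
    (k x₀ y₀ e : ℝ) (hk : 0 < k) (hy₀ : 0 < y₀) (he : e ≠ x₀) :
    ∃! ac : ℝ × ℝ, 0 < ac.1 ∧
      (x₀ - ac.2) ^ 2 + k ^ 2 * y₀ ^ 2 = ac.1 ^ 2 ∧
      (e = ac.2 - ac.1 ∨ e = ac.2 + ac.1) := by
  have hd : e - x₀ ≠ 0 := sub_ne_zero.mpr he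
  have hK : 0 < k ^ 2 * y₀ ^ 2 := by positivity
  obtain ⟨c, hc⟩ : ∃ c : ℝ, 2 * (e - x₀) * c = e ^ 2 - x₀ ^ 2 - k ^ 2 * y₀ ^ 2 :=
    ⟨(e ^ 2 - x₀ ^ 2 - k ^ 2 * y₀ ^ 2) / (2 * (e - x₀)), by field_simp⟩
  have hne : e - c ≠ 0 := by
    intro h
    have h2 : (x₀ - c) ^ 2 + k ^ 2 * y₀ ^ 2 = (e - c) ^ 2 := by linarith
    rw [h] at h2
    nlinarith [sq_nonneg (x₀ - c)]
  refine ⟨(|e - c|, c), ⟨abs_pos.mpr hne, ?_, ?_⟩, ?_⟩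
  · simp only [sq_abs]
    linarith
  · rcases abs_choice (e - c) with h | h
    · right
      simp only [h]
      ring
    · left
      simp only [h]
      ring
  · rintro ⟨a, c'⟩ ⟨ha, h1, h2⟩
    simp only at ha h1 h2
    have h3 : (e - c') ^ 2 = a ^ 2 := by
      rcases h2 with h | h <;> rw [h] <;> ring
    have h4 : c' = c := by
      apply mul_left_cancel₀ (mul_ne_zero two_ne_zero hd)
      linarith
    subst h4
    have h5 : a = |e - c'| := by
      rw [← abs_of_pos ha]
      exact ((sq_eq_sq_iff_abs_eq_abs _ _).mp h3).symm
    rw [h5]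
end

section
/- Fix a real constant k > 0, reals c and a > 0, and a point P = (x₀, y₀) with y₀ > 0 that does not lie on the half-ellipse L = L_{kac} and with x₀ ∉ {c − a, c + a}. Then, among all h-lines of ℍ_k (i.e., subsets of the upper half-plane of the form L_p or L_{ka′c′}), there are exactly two that contain P and are parallel to L, where an h-line is parallel to L_{kac} iff its Euclidean extension passes through (c − a, 0) or (c + a, 0). -/
/-- The vertical h-line `L_p = {(p, y) : y > 0}`. -/
def verticalHLine (p : ℝ) : Set (ℝ × ℝ) := {q | q.1 = p ∧ 0 < q.2}

/-- The half-ellipse `L_{kac} = {(x, y) : (x - c)^2 + k^2 y^2 = a^2, y > 0}`. -/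
def halfEllipse (k a c : ℝ) : Set (ℝ × ℝ) :=
  {q | (q.1 - c) ^ 2 + k ^ 2 * q.2 ^ 2 = a ^ 2 ∧ 0 < q.2}

/-- `l` is an h-line of `ℍ_k`. -/
def IsHLine (k : ℝ) (l : Set (ℝ × ℝ)) : Prop :=
  (∃ p, l = verticalHLine p) ∨ ∃ a c, 0 < a ∧ l = halfEllipse k a c

/-- The h-line `l` is parallel to the half-ellipse `L_{kac}`: its Euclidean
extension passes through `(c - a, 0)` or `(c + a, 0)`.  For a vertical h-line
`L_p` the Euclidean extension meets the x-axis at `(p, 0)`; for a half-ellipse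
`L_{ka'c'}` it meets the x-axis at `(c' - a', 0)` and `(c' + a', 0)`. -/
def ParallelToEllipse (k a c : ℝ) (l : Set (ℝ × ℝ)) : Prop :=
  (∃ p, l = verticalHLine p ∧ (p = c - a ∨ p = c + a)) ∨
  (∃ a' c', 0 < a' ∧ l = halfEllipse k a' c' ∧
    (c' - a' = c - a ∨ c' - a' = c + a ∨ c' + a' = c - a ∨ c' + a' = c + a))

lemma halfEllipse_mem_iff (k r m x y : ℝ) :
    (x, y) ∈ halfEllipse k r m ↔ (x - m) ^ 2 + k ^ 2 * y ^ 2 = r ^ 2 ∧ 0 < y := Iff.rfl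

lemma halfEllipse_inj {k r m r' m' : ℝ} (hk : 0 < k) (hr : 0 < r) (hr' : 0 < r')
    (h : halfEllipse k r m = halfEllipse k r' m') : r = r' ∧ m = m' := by
  have h1 : (m, r / k) ∈ halfEllipse k r' m' := by
    rw [← h, halfEllipse_mem_iff]
    refine ⟨?_, by positivity⟩
    field_simp
    ring
  have h2 : (m', r' / k) ∈ halfEllipse k r m := by
    rw [h, halfEllipse_mem_iff]
    refine ⟨?_, by positivity⟩
    field_simp
    ring
  rw [halfEllipse_mem_iff] at h1 h2
  have e1 : k ^ 2 * (r / k) ^ 2 = r ^ 2 := by field_simp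
  have e2 : k ^ 2 * (r' / k) ^ 2 = r' ^ 2 := by field_simp
  rw [e1] at h1
  rw [e2] at h2
  have hm : (m - m') ^ 2 = 0 := by nlinarith [h1.1, h2.1, sq_nonneg (m - m')]
  have hm' : m = m' := by
    have := pow_eq_zero_iff (two_ne_zero) |>.1 hm
    linarith
  subst hm'
  refine ⟨?_, rfl⟩
  have h3 : r ^ 2 = r' ^ 2 := by linarith [h1.1]
  exact (pow_left_inj₀ hr.le hr'.le two_ne_zero).1 h3

/-- For each ideal point `p ≠ x₀` there is a unique half-ellipse through it and the point. -/
lemma exists_ellipse (k x y p : ℝ) (hk : 0 < k) (hy : 0 < y) (hp : x ≠ p) :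
    ∃ r m : ℝ, 0 < r ∧ (x, y) ∈ halfEllipse k r m ∧ (m - r = p ∨ m + r = p) ∧
      ∀ r' m' : ℝ, 0 < r' → (x, y) ∈ halfEllipse k r' m' → (m' - r' = p ∨ m' + r' = p) →
        r' = r ∧ m' = m := by
  have hd : x - p ≠ 0 := sub_ne_zero.2 hp
  obtain ⟨t, ht⟩ : ∃ t : ℝ, 2 * (x - p) * t = (x - p) ^ 2 + k ^ 2 * y ^ 2 :=
    ⟨((x - p) ^ 2 + k ^ 2 * y ^ 2) / (2 * (x - p)), by field_simp⟩
  have ht0 : t ≠ 0 := by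
    rintro rfl
    have : 0 < (x - p) ^ 2 + k ^ 2 * y ^ 2 := by positivity
    linarith
  refine ⟨|t|, p + t, abs_pos.2 ht0, ?_, ?_, ?_⟩
  · rw [halfEllipse_mem_iff, sq_abs]
    exact ⟨by linear_combination -ht, hy⟩
  · rcases abs_choice t with h | h <;> rw [h]
    · left; ring
    · right; ring
  · intro r' m' hr' hm h
    rw [halfEllipse_mem_iff] at hm
    have hsq : r' ^ 2 = (m' - p) ^ 2 := by
      rcases h with h | h <;> rw [← h] <;> ring
    have hmt : m' = p + t := by
      have : 2 * (x - p) * (m' - (p + t)) = 0 := by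
        linear_combination -ht - hm.1 - hsq
      rcases mul_eq_zero.1 this with h0 | h0
      · exact absurd (by linarith) hd
      · linarith
    refine ⟨?_, hmt⟩
    rw [hmt, add_sub_cancel_left] at hsq
    rw [← abs_of_pos hr']
    exact (sq_eq_sq_iff_abs_eq_abs _ _).1 hsq

/-- For `k > 0`, `a > 0` and a point `P = (x₀, y₀)` of the upper
half-plane not on the half-ellipse `L = L_{kac}` and with
`x₀ ∉ {c - a, c + a}`, there are exactly two h-lines of `ℍ_k` containing `P`
and parallel to `L`. -/
theorem exactly_two_parallels_through_point
    (k a c x₀ y₀ : ℝ) (hk : 0 < k) (ha : 0 < a) (hy₀ : 0 < y₀)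
    (hP : (x₀, y₀) ∉ halfEllipse k a c)
    (hx₀ : x₀ ≠ c - a ∧ x₀ ≠ c + a) :
    ∃ l₁ l₂ : Set (ℝ × ℝ), l₁ ≠ l₂ ∧
      ∀ l : Set (ℝ × ℝ),
        (IsHLine k l ∧ (x₀, y₀) ∈ l ∧ ParallelToEllipse k a c l) ↔
        (l = l₁ ∨ l = l₂) := by
  obtain ⟨r₁, m₁, hr₁, hm₁, he₁, hu₁⟩ := exists_ellipse k x₀ y₀ (c - a) hk hy₀ hx₀.1
  obtain ⟨r₂, m₂, hr₂, hm₂, he₂, hu₂⟩ := exists_ellipse k x₀ y₀ (c + a) hk hy₀ hx₀.2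
  refine ⟨halfEllipse k r₁ m₁, halfEllipse k r₂ m₂, ?_, ?_⟩
  · intro h
    obtain ⟨rfl, rfl⟩ := halfEllipse_inj hk hr₁ hr₂ h
    apply hP
    have : r₁ = a ∧ m₁ = c := by
      rcases he₁ with h1 | h1 <;> rcases he₂ with h2 | h2 <;> constructor <;> linarith
    rw [← this.1, ← this.2]
    exact hm₁
  · intro l
    constructor
    · rintro ⟨-, hl, ⟨p, rfl, hp⟩ | ⟨a', c', ha', rfl, h⟩⟩
      · have hxp : x₀ = p := hl.1
        rcases hp with hp | hp
        · exact absurd (hxp.trans hp) hx₀.1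
        · exact absurd (hxp.trans hp) hx₀.2
      · have h' : (c' - a' = c - a ∨ c' + a' = c - a) ∨ (c' - a' = c + a ∨ c' + a' = c + a) := by
          tauto
        rcases h' with h' | h'
        · obtain ⟨rfl, rfl⟩ := hu₁ a' c' ha' hl h'
          exact Or.inl rfl
        · obtain ⟨rfl, rfl⟩ := hu₂ a' c' ha' hl h'
          exact Or.inr rfl
    · rintro (rfl | rfl)
      · exact ⟨Or.inr ⟨r₁, m₁, hr₁, rfl⟩, hm₁, Or.inr ⟨r₁, m₁, hr₁, rfl, by tauto⟩⟩
      · exact ⟨Or.inr ⟨r₂, m₂, hr₂, rfl⟩, hm₂, Or.inr ⟨r₂, m₂, hr₂, rfl, by tauto⟩⟩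
end

section
/- Fix a real constant k > 0, reals c and a > 0, and let P = (x₁, y₁) and Q = (x₂, y₂) be two distinct points both lying on the half-ellipse L_{kac} (i.e., (xᵢ − c)² + k²yᵢ² = a², yᵢ > 0, (x₁, y₁) ≠ (x₂, y₂)). Then the distance d(P, Q) = |ln( ((x₁ − c + a)·y₂) / ((x₂ − c + a)·y₁) )| is strictly positive; it equals 0 if and only if P = Q, and d(P, Q) = d(Q, P). -/
/-- The distance `d(P, Q) = |ln(((x₁ - c + a) y₂) / ((x₂ - c + a) y₁))|` for
points on `L_{kac}`. -/
noncomputable def pDist (a c : ℝ) (P Q : ℝ × ℝ) : ℝ :=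
  |Real.log (((P.1 - c + a) * Q.2) / ((Q.1 - c + a) * P.2))|

/-- For `k > 0`, `a > 0` and two distinct points `P, Q` on the
half-ellipse `L_{kac}`, the distance `d(P, Q)` is strictly positive; it is zero
iff `P = Q`, and it is symmetric. -/
theorem pDist_pos_of_ne
    (k a c : ℝ) (hk : 0 < k) (ha : 0 < a) (P Q : ℝ × ℝ)
    (hP : P ∈ halfEllipse k a c) (hQ : Q ∈ halfEllipse k a c)
    (hne : P ≠ Q) :
    0 < pDist a c P Q ∧
    (pDist a c P Q = 0 ↔ P = Q) ∧
    pDist a c P Q = pDist a c Q P := by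
  obtain ⟨x₁, y₁⟩ := P
  obtain ⟨x₂, y₂⟩ := Q
  obtain ⟨h1, hy1⟩ := hP
  obtain ⟨h2, hy2⟩ := hQ
  simp only at h1 hy1 h2 hy2
  have key : ∀ x y : ℝ, (x - c) ^ 2 + k ^ 2 * y ^ 2 = a ^ 2 → 0 < y → 0 < x - c + a := by
    intro x y h hy
    have hp : 0 < k ^ 2 * y ^ 2 := by positivity
    have := abs_lt_of_sq_lt_sq (show (x - c) ^ 2 < a ^ 2 by linarith) ha.le
    linarith [(abs_lt.mp this).1]
  have hu := key x₁ y₁ h1 hy1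
  have hv := key x₂ y₂ h2 hy2
  have hlog : Real.log (((x₁ - c + a) * y₂) / ((x₂ - c + a) * y₁)) ≠ 0 := by
    intro h0
    apply hne
    have hr : ((x₁ - c + a) * y₂) / ((x₂ - c + a) * y₁) = 1 :=
      Real.eq_one_of_pos_of_log_eq_zero (by positivity) h0
    rw [div_eq_one_iff_eq (by positivity)] at hr
    have hx : x₁ = x₂ := by
      have e : ((x₁ - c + a) * (x₂ - c + a) * (2 * a)) * (x₁ - x₂) = 0 := by
        linear_combination k ^ 2 * ((x₁ - c + a) * y₂ + (x₂ - c + a) * y₁) * hr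
          + (x₂ - c + a) ^ 2 * h1 - (x₁ - c + a) ^ 2 * h2
      rcases mul_eq_zero.mp e with e | e
      · exact absurd e (by positivity)
      · linarith
    subst hx
    have hy : y₁ = y₂ := (mul_left_cancel₀ hu.ne' hr).symm
    rw [hy]
  have hpos : 0 < pDist a c (x₁, y₁) (x₂, y₂) := abs_pos.mpr hlog
  refine ⟨hpos, ⟨fun h => absurd h hpos.ne', fun h => absurd h hne⟩, ?_⟩
  unfold pDist
  rw [← abs_neg, ← Real.log_inv, inv_div]
end

section
/- Fix a real constant k > 0, reals c and a > 0, and let l be any h-line of ℍ_k (a vertical half-line L_p or a half-ellipse L_{ka′c′}). If l contains a point A = (x_A, y_A) with (x_A − c)² + k²y_A² < a² and a point B = (x_B, y_B) with (x_B − c)² + k²y_B² > a², then l intersects the half-ellipse L_{kac} = {(x, y) : (x − c)² + k²y² = a², y > 0}. -/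
/-- If an h-line `l` of `ℍ_k` contains a point `A` strictly
inside the half-ellipse `L_{kac}` (i.e. `(x_A - c)^2 + k^2 y_A^2 < a^2`) and a
point `B` strictly outside it, then `l` intersects `L_{kac}`. -/
theorem hline_crossing_halfEllipse_intersects
    (k a c : ℝ) (hk : 0 < k) (ha : 0 < a)
    (l : Set (ℝ × ℝ)) (hl : IsHLine k l)
    (A B : ℝ × ℝ) (hA : A ∈ l) (hB : B ∈ l)
    (hAin : (A.1 - c) ^ 2 + k ^ 2 * A.2 ^ 2 < a ^ 2)
    (hBout : a ^ 2 < (B.1 - c) ^ 2 + k ^ 2 * B.2 ^ 2) :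
    (l ∩ halfEllipse k a c).Nonempty := by
  rcases hl with ⟨p, rfl⟩ | ⟨b, d, hb, rfl⟩
  · obtain ⟨h1, h2⟩ := hA
    rw [h1] at hAin
    have hpos : 0 < a ^ 2 - (p - c) ^ 2 := by
      have : 0 < k ^ 2 * A.2 ^ 2 := by positivity
      linarith
    have hy : 0 < Real.sqrt (a ^ 2 - (p - c) ^ 2) / k := div_pos (Real.sqrt_pos.mpr hpos) hk
    refine ⟨(p, Real.sqrt (a ^ 2 - (p - c) ^ 2) / k), ⟨rfl, hy⟩, ?_, hy⟩
    simp only [div_pow, Real.sq_sqrt hpos.le]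
    field_simp
    ring
  · obtain ⟨x, u⟩ := A
    obtain ⟨z, v⟩ := B
    obtain ⟨h1, h2⟩ := hA
    obtain ⟨h3, h4⟩ := hB
    simp only at h1 h2 h3 h4 hAin hBout
    have hu : 0 < k ^ 2 * u ^ 2 := by positivity
    have hv : 0 < k ^ 2 * v ^ 2 := by positivity
    -- on the half-ellipse the defining function is affine in the abscissa
    obtain ⟨f, hf⟩ : ∃ f, f = (x - c) ^ 2 + k ^ 2 * u ^ 2 := ⟨_, rfl⟩
    obtain ⟨g, hg⟩ : ∃ g, g = (z - c) ^ 2 + k ^ 2 * v ^ 2 := ⟨_, rfl⟩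
    rw [← hf] at hAin
    rw [← hg] at hBout
    have hfg : 0 < g - f := by linarith
    obtain ⟨t, ht⟩ : ∃ t, t = (a ^ 2 - f) / (g - f) := ⟨_, rfl⟩
    have ht0 : 0 < t := by rw [ht]; exact div_pos (by linarith) hfg
    have ht1 : t < 1 := by rw [ht, div_lt_one hfg]; linarith
    have hta : f + t * (g - f) = a ^ 2 := by
      rw [ht, div_mul_cancel₀ _ hfg.ne']; ring
    obtain ⟨w, hw⟩ : ∃ w, w = x + t * (z - x) := ⟨_, rfl⟩
    have hpos : 0 < b ^ 2 - (w - d) ^ 2 := by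
      have e : b ^ 2 - (w - d) ^ 2 = (1 - t) * (k ^ 2 * u ^ 2) + t * (k ^ 2 * v ^ 2)
          + t * (1 - t) * (z - x) ^ 2 := by
        rw [hw]
        linear_combination (-(1 - t)) * h1 - t * h3
      rw [e]
      have : 0 < 1 - t := by linarith
      positivity
    have hy : 0 < Real.sqrt (b ^ 2 - (w - d) ^ 2) / k := div_pos (Real.sqrt_pos.mpr hpos) hk
    have hk2 : k ^ 2 * (Real.sqrt (b ^ 2 - (w - d) ^ 2) / k) ^ 2 = b ^ 2 - (w - d) ^ 2 := by
      rw [div_pow, Real.sq_sqrt hpos.le]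
      field_simp
    refine ⟨(w, Real.sqrt (b ^ 2 - (w - d) ^ 2) / k), ⟨?_, hy⟩, ?_, hy⟩
    · simp only [hk2]; ring
    · simp only [hk2]
      rw [← hta, hf, hg, hw]
      linear_combination (-(1 - t)) * h1 - t * h3
end

section
/- Fix a real constant k > 0 and a real p, and let l be any h-line of ℍ_k (a vertical half-line L_q or a half-ellipse L_{ka′c′}). If l contains a point A = (x_A, y_A) with x_A < p and a point B = (x_B, y_B) with x_B > p, then l intersects the vertical h-line L_p = {(p, y) : y > 0}. -/
/-- If an h-line `l` of `ℍ_k` contains a point `A` with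
`x_A < p` and a point `B` with `x_B > p`, then `l` intersects the vertical
h-line `L_p`. -/
theorem hline_crossing_vertical_intersects
    (k p : ℝ) (hk : 0 < k)
    (l : Set (ℝ × ℝ)) (hl : IsHLine k l)
    (A B : ℝ × ℝ) (hA : A ∈ l) (hB : B ∈ l)
    (hAx : A.1 < p) (hBx : p < B.1) :
    (l ∩ verticalHLine p).Nonempty := by
  rcases hl with ⟨q, rfl⟩ | ⟨a, c, ha, rfl⟩
  · have h1 : A.1 = q := hA.1
    have h2 : B.1 = q := hB.1
    linarith
  · obtain ⟨hA1, hA2⟩ := hA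
    obtain ⟨hB1, hB2⟩ := hB
    have hkA : 0 < k ^ 2 * A.2 ^ 2 := by positivity
    have hkB : 0 < k ^ 2 * B.2 ^ 2 := by positivity
    have h1 : -a < A.1 - c := (abs_lt_of_sq_lt_sq' (by linarith) ha.le).1
    have h2 : B.1 - c < a := (abs_lt_of_sq_lt_sq' (by linarith) ha.le).2
    have hpos : 0 < a ^ 2 - (p - c) ^ 2 := by
      have h3 : 0 < a - (p - c) := by linarith
      have h4 : 0 < a + (p - c) := by linarith
      nlinarith [mul_pos h3 h4]
    have hy : 0 < Real.sqrt (a ^ 2 - (p - c) ^ 2) / k := div_pos (Real.sqrt_pos.2 hpos) hk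
    refine ⟨(p, Real.sqrt (a ^ 2 - (p - c) ^ 2) / k), ⟨?_, hy⟩, rfl, hy⟩
    show (p - c) ^ 2 + k ^ 2 * (Real.sqrt (a ^ 2 - (p - c) ^ 2) / k) ^ 2 = a ^ 2
    rw [div_pow, Real.sq_sqrt hpos.le, mul_div_cancel₀ _ (by positivity)]
    ring
end

section
/- Fix a real constant k > 0, a real p, and a point P = (x₀, y₀) with y₀ > 0 and x₀ > p. For every real e with p < e < x₀, the unique half-ellipse L_{ka_e c_e} through P having e as an endpoint with e = c_e − a_e (left endpoint) is disjoint from the vertical h-line L_p = {(p, y) : y > 0}; moreover distinct values of e give distinct half-ellipses. Consequently, there are infinitely many h-lines of ℍ_k through P that are disjoint from L_p. -/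
/-- Let `k > 0`, `p ∈ ℝ` and `P = (x₀, y₀)` with `y₀ > 0` and
`x₀ > p`.  For each `e` with `p < e < x₀` there is a unique half-ellipse
through `P` with left endpoint `e = c - a`; any such half-ellipse is disjoint
from `L_p`; distinct values of `e` give distinct half-ellipses; consequently
there are infinitely many h-lines of `ℍ_k` through `P` disjoint from `L_p`. -/
theorem infinitely_many_disjoint_hlines
    (k p x₀ y₀ : ℝ) (hk : 0 < k) (hy₀ : 0 < y₀) (hx₀ : p < x₀) :
    (∀ e : ℝ, p < e → e < x₀ →
        ∃! ac : ℝ × ℝ, 0 < ac.1 ∧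
          (x₀ - ac.2) ^ 2 + k ^ 2 * y₀ ^ 2 = ac.1 ^ 2 ∧ e = ac.2 - ac.1) ∧
    (∀ e a c : ℝ, p < e → e < x₀ → 0 < a →
        (x₀ - c) ^ 2 + k ^ 2 * y₀ ^ 2 = a ^ 2 → e = c - a →
        halfEllipse k a c ∩ verticalHLine p = ∅) ∧
    (∀ e₁ e₂ a₁ c₁ a₂ c₂ : ℝ, p < e₁ → e₁ < x₀ → p < e₂ → e₂ < x₀ →
        0 < a₁ → 0 < a₂ →
        (x₀ - c₁) ^ 2 + k ^ 2 * y₀ ^ 2 = a₁ ^ 2 → e₁ = c₁ - a₁ →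
        (x₀ - c₂) ^ 2 + k ^ 2 * y₀ ^ 2 = a₂ ^ 2 → e₂ = c₂ - a₂ →
        e₁ ≠ e₂ → halfEllipse k a₁ c₁ ≠ halfEllipse k a₂ c₂) ∧
    {l : Set (ℝ × ℝ) | IsHLine k l ∧ (x₀, y₀) ∈ l ∧
        l ∩ verticalHLine p = ∅}.Infinite := by
  have hex : ∀ e : ℝ, p < e → e < x₀ →
        ∃! ac : ℝ × ℝ, 0 < ac.1 ∧
          (x₀ - ac.2) ^ 2 + k ^ 2 * y₀ ^ 2 = ac.1 ^ 2 ∧ e = ac.2 - ac.1 := by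
    intro e _ he
    have hd : 0 < x₀ - e := sub_pos.mpr he
    refine ⟨(((x₀ - e) ^ 2 + k ^ 2 * y₀ ^ 2) / (2 * (x₀ - e)),
      e + ((x₀ - e) ^ 2 + k ^ 2 * y₀ ^ 2) / (2 * (x₀ - e))), ⟨?_, ?_, ?_⟩, ?_⟩
    · dsimp only
      positivity
    · dsimp only
      have h : ((x₀ - e) ^ 2 + k ^ 2 * y₀ ^ 2) / (2 * (x₀ - e)) * (2 * (x₀ - e))
          = (x₀ - e) ^ 2 + k ^ 2 * y₀ ^ 2 := div_mul_cancel₀ _ (by positivity)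
      generalize ((x₀ - e) ^ 2 + k ^ 2 * y₀ ^ 2) / (2 * (x₀ - e)) = a at h
      linear_combination -h
    · dsimp only
      ring
    · rintro ⟨a, c⟩ ⟨_, h2, h3⟩
      dsimp only at h2 h3
      have hc : c = e + a := by linarith
      have ha : a = ((x₀ - e) ^ 2 + k ^ 2 * y₀ ^ 2) / (2 * (x₀ - e)) := by
        rw [eq_div_iff (by positivity)]
        subst hc
        linear_combination -h2
      rw [hc, ← ha]
  have hdis : ∀ e a c : ℝ, p < e → e < x₀ → 0 < a →
        (x₀ - c) ^ 2 + k ^ 2 * y₀ ^ 2 = a ^ 2 → e = c - a →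
        halfEllipse k a c ∩ verticalHLine p = ∅ := by
    intro e a c h1 _ ha _ h3
    rw [Set.eq_empty_iff_forall_notMem]
    rintro ⟨x, y⟩ ⟨⟨h4, _⟩, h5, _⟩
    dsimp only at h4 h5
    subst h5
    have h6 : 0 ≤ k ^ 2 * y ^ 2 := by positivity
    nlinarith
  have hne : ∀ a₁ c₁ a₂ c₂ : ℝ, 0 < a₁ → 0 < a₂ →
      halfEllipse k a₁ c₁ = halfEllipse k a₂ c₂ → c₁ - a₁ = c₂ - a₂ := by
    intro a₁ c₁ a₂ c₂ h1 h2 h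
    have top : ∀ a c : ℝ, 0 < a → (c, a / k) ∈ halfEllipse k a c := by
      intro a c ha
      refine ⟨?_, div_pos ha hk⟩
      dsimp only
      field_simp
      ring
    have t1 := (h ▸ top a₁ c₁ h1 : (c₁, a₁ / k) ∈ halfEllipse k a₂ c₂).1
    have t2 := (h.symm ▸ top a₂ c₂ h2 : (c₂, a₂ / k) ∈ halfEllipse k a₁ c₁).1
    dsimp only at t1 t2
    have e1 : k ^ 2 * (a₁ / k) ^ 2 = a₁ ^ 2 := by field_simp
    have e2 : k ^ 2 * (a₂ / k) ^ 2 = a₂ ^ 2 := by field_simp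
    rw [e1] at t1
    rw [e2] at t2
    have hc : c₁ - c₂ = 0 := by
      have : (c₁ - c₂) ^ 2 = 0 := by linarith [sub_sq_comm c₁ c₂]
      exact pow_eq_zero_iff (two_ne_zero) |>.mp this
    rw [hc] at t1
    have ha : a₁ = a₂ := by
      rw [← sq_eq_sq₀ h1.le h2.le]
      linarith
    linarith
  refine ⟨hex, hdis, ?_, ?_⟩
  · intro e₁ e₂ a₁ c₁ a₂ c₂ _ _ _ _ ha₁ ha₂ _ h1 _ h2 hn h
    exact hn (by rw [h1, h2]; exact hne _ _ _ _ ha₁ ha₂ h)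
  · have hex' : ∀ e : ℝ, ∃ ac : ℝ × ℝ, p < e → e < x₀ → 0 < ac.1 ∧
          (x₀ - ac.2) ^ 2 + k ^ 2 * y₀ ^ 2 = ac.1 ^ 2 ∧ e = ac.2 - ac.1 := by
      intro e
      by_cases h : p < e ∧ e < x₀
      · obtain ⟨ac, hac, _⟩ := hex e h.1 h.2
        exact ⟨ac, fun _ _ => hac⟩
      · exact ⟨0, fun h1 h2 => absurd ⟨h1, h2⟩ h⟩
    choose f hf using hex'
    refine Set.infinite_of_injOn_mapsTo (s := Set.Ioo p x₀)
      (f := fun e => halfEllipse k (f e).1 (f e).2) ?_ ?_ (Set.Ioo_infinite hx₀)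
    · intro e₁ h1 e₂ h2 h
      obtain ⟨p1, _, q1⟩ := hf e₁ h1.1 h1.2
      obtain ⟨p2, _, q2⟩ := hf e₂ h2.1 h2.2
      rw [q1, q2]
      exact hne _ _ _ _ p1 p2 h
    · intro e h
      obtain ⟨p1, r1, q1⟩ := hf e h.1 h.2
      exact ⟨Or.inr ⟨_, _, p1, rfl⟩, ⟨r1, hy₀⟩, hdis e _ _ h.1 h.2 p1 r1 q1⟩
end
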